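/- Let μ, λ be real constants, and let u : ℝ³×[0,∞) → ℝ³, ρ, p : ℝ³×[0,∞) → ℝ, F : ℝ³×[0,∞) → ℝ³ be smooth, with ρ everywhere positive, satisfying the momentum equation ρ(∂_t u + (u·∇)u) = μΔu − ∇(p − λφ) + ρF on ℝ³×(0,∞), where φ = ∇·u. Then the expansion rate φ satisfies on ℝ³×(0,∞): ∂_t φ = Σ_i ∂_i( ((μ+λ)/ρ) ∂_i φ ) − (u·∇)φ − ∇(1/ρ)·∇p − μ ∇(1/ρ)·(∇∧ω) + |ω|² − Σ_{i,j} (∂_j u^i)² − (1/ρ)Δp + ∇·F, where ω = ∇∧u is the vorticity and |ω|² is its squared Euclidean norm. -/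

import Mathlib

noncomputable section

/-- Spatial partial derivative in the `j`-th coordinate direction. -/
def pd (j : Fin 3) (f : (Fin 3 → ℝ) → ℝ) (x : Fin 3 → ℝ) : ℝ :=
  fderiv ℝ f x (Pi.single j 1)

/-- The Levi-Civita symbol on `Fin 3`. -/
def eps (i j k : Fin 3) : ℝ :=
  (((j : ℕ) : ℝ) - ((i : ℕ) : ℝ)) * (((k : ℕ) : ℝ) - ((i : ℕ) : ℝ)) *
    (((k : ℕ) : ℝ) - ((j : ℕ) : ℝ)) / 2

/-- The vorticity `ω(x,t) = ∇∧u(x,t)` of a time-dependent velocity field,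
`ω^i = Σ_{j,k} ε^{ijk} ∂_j u^k`. -/
def vort (u : (Fin 3 → ℝ) → ℝ → Fin 3 → ℝ) (x : Fin 3 → ℝ) (t : ℝ) (i : Fin 3) : ℝ :=
  ∑ j, ∑ k, eps i j k * pd j (fun y => u y t k) x

/-- The expansion rate `φ(x,t) = ∇·u(x,t)` of a time-dependent velocity field. -/
def expR (u : (Fin 3 → ℝ) → ℝ → Fin 3 → ℝ) (x : Fin 3 → ℝ) (t : ℝ) : ℝ :=
  ∑ i, pd i (fun y => u y t i) x

open scoped ContDiff

lemma pd_smooth (i : Fin 3) {f : (Fin 3 → ℝ) → ℝ} (hf : ContDiff ℝ ∞ f) :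
    ContDiff ℝ ∞ (pd i f) := by
  have h : ContDiff ℝ ∞ (fderiv ℝ f) := hf.fderiv_right (m := ∞) (by simp)
  exact h.clm_apply contDiff_const

lemma smooth_diffAt {f : (Fin 3 → ℝ) → ℝ} (hf : ContDiff ℝ ∞ f) (x : Fin 3 → ℝ) :
    DifferentiableAt ℝ f x := (hf.differentiable (by simp)) x

lemma pd_add' (i : Fin 3) {f g : (Fin 3 → ℝ) → ℝ} (hf : ContDiff ℝ ∞ f) (hg : ContDiff ℝ ∞ g)
    (x : Fin 3 → ℝ) : pd i (fun y => f y + g y) x = pd i f x + pd i g x := by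
  unfold pd
  rw [fderiv_fun_add (smooth_diffAt hf x) (smooth_diffAt hg x)]; rfl

lemma pd_sub' (i : Fin 3) {f g : (Fin 3 → ℝ) → ℝ} (hf : ContDiff ℝ ∞ f) (hg : ContDiff ℝ ∞ g)
    (x : Fin 3 → ℝ) : pd i (fun y => f y - g y) x = pd i f x - pd i g x := by
  unfold pd
  rw [fderiv_fun_sub (smooth_diffAt hf x) (smooth_diffAt hg x)]; rfl

lemma pd_mul' (i : Fin 3) {f g : (Fin 3 → ℝ) → ℝ} (hf : ContDiff ℝ ∞ f) (hg : ContDiff ℝ ∞ g)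
    (x : Fin 3 → ℝ) : pd i (fun y => f y * g y) x = f x * pd i g x + pd i f x * g x := by
  unfold pd
  rw [fderiv_fun_mul (smooth_diffAt hf x) (smooth_diffAt hg x)]
  simp [mul_comm]

lemma pd_cmul (i : Fin 3) (c : ℝ) {f : (Fin 3 → ℝ) → ℝ} (hf : ContDiff ℝ ∞ f)
    (x : Fin 3 → ℝ) : pd i (fun y => c * f y) x = c * pd i f x := by
  unfold pd
  rw [fderiv_const_mul (smooth_diffAt hf x)]; rfl

lemma pd_sum' (i : Fin 3) {f : Fin 3 → (Fin 3 → ℝ) → ℝ} (hf : ∀ j, ContDiff ℝ ∞ (f j))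
    (x : Fin 3 → ℝ) : pd i (fun y => ∑ j, f j y) x = ∑ j, pd i (f j) x := by
  unfold pd
  rw [fderiv_fun_sum (fun j _ => smooth_diffAt (hf j) x)]; simp

lemma pd_comm (i j : Fin 3) {f : (Fin 3 → ℝ) → ℝ} (hf : ContDiff ℝ ∞ f) (x : Fin 3 → ℝ) :
    pd i (pd j f) x = pd j (pd i f) x := by
  have h : ContDiff ℝ ∞ (fderiv ℝ f) := hf.fderiv_right (m := ∞) (by simp)
  have hd : DifferentiableAt ℝ (fderiv ℝ f) x := (h.differentiable (by simp)) x
  have hs : IsSymmSndFDerivAt ℝ f x :=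
    hf.contDiffAt.isSymmSndFDerivAt (by simp only [minSmoothness_of_isRCLikeNormedField]; exact WithTop.coe_le_coe.2 le_top)
  have e : ∀ a b, pd a (pd b f) x = fderiv ℝ (fderiv ℝ f) x (Pi.single a 1) (Pi.single b 1) := by
    intro a b
    show fderiv ℝ (fun y => fderiv ℝ f y (Pi.single b 1)) x _ = _
    rw [fderiv_clm_apply hd (differentiableAt_const _)]
    simp
  rw [e, e]; exact hs _ _

/-- time and space derivatives commute -/
lemma pd_time (i : Fin 3) {g : (Fin 3 → ℝ) × ℝ → ℝ}
    (hg : ∀ q : (Fin 3 → ℝ) × ℝ, 0 < q.2 → ContDiffAt ℝ ∞ g q) (x : Fin 3 → ℝ) (t : ℝ)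
    (ht : 0 < t) :
    HasDerivAt (fun s => pd i (fun y => g (y, s)) x)
      (pd i (fun y => deriv (fun s => g (y, s)) t) x) t := by
  have hgd : ∀ q : (Fin 3 → ℝ) × ℝ, 0 < q.2 → DifferentiableAt ℝ g q :=
    fun q hq => (hg q hq).differentiableAt (by simp)
  have h : ContDiffAt ℝ ∞ (fderiv ℝ g) (x, t) := (hg (x, t) ht).fderiv_right (m := ∞) (by simp)
  have hd : DifferentiableAt ℝ (fderiv ℝ g) (x, t) := h.differentiableAt (by simp)
  have hs : IsSymmSndFDerivAt ℝ g (x, t) :=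
    (hg (x, t) ht).isSymmSndFDerivAt (by simp only [minSmoothness_of_isRCLikeNormedField]; exact WithTop.coe_le_coe.2 le_top)
  have e1 : ∀ s, 0 < s → ∀ y, pd i (fun y => g (y, s)) y
      = fderiv ℝ g (y, s) (Pi.single i 1, 0) := by
    intro s hs' y
    have h1 : HasFDerivAt (fun y : Fin 3 → ℝ => (y, s))
        (ContinuousLinearMap.inl ℝ (Fin 3 → ℝ) ℝ) y := hasFDerivAt_prodMk_left y s
    have h2 := HasFDerivAt.comp y (hgd (y, s) hs').hasFDerivAt h1
    have h3 := h2.fderiv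
    unfold pd
    change fderiv ℝ (g ∘ fun y => (y, s)) y _ = _
    rw [h3]; simp
  have e2 : ∀ y, deriv (fun s => g (y, s)) t = fderiv ℝ g (y, t) (0, 1) := by
    intro y
    have h1 : HasFDerivAt (fun s : ℝ => (y, s))
        (ContinuousLinearMap.inr ℝ (Fin 3 → ℝ) ℝ) t := hasFDerivAt_prodMk_right y t
    have h2 := HasFDerivAt.comp t (hgd (y, t) ht).hasFDerivAt h1
    have h3 := h2.hasDerivAt.deriv
    change deriv (g ∘ fun s => (y, s)) t = _
    rw [h3]; simp
  have f1 : HasDerivAt (fun s => fderiv ℝ g (x, s) (Pi.single i 1, 0))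
      (fderiv ℝ (fderiv ℝ g) (x, t) (0, 1) (Pi.single i 1, 0)) t := by
    have h1 : HasFDerivAt (fun s : ℝ => (x, s))
        (ContinuousLinearMap.inr ℝ (Fin 3 → ℝ) ℝ) t := hasFDerivAt_prodMk_right x t
    have h2 := (HasFDerivAt.comp t hd.hasFDerivAt h1).clm_apply
      (hasFDerivAt_const ((Pi.single i 1, 0) : (Fin 3 → ℝ) × ℝ) t)
    have h3 := h2.hasDerivAt
    simpa using h3
  have f2 : pd i (fun y => fderiv ℝ g (y, t) (0, 1)) x
      = fderiv ℝ (fderiv ℝ g) (x, t) (Pi.single i 1, 0) (0, 1) := by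
    have h1 : HasFDerivAt (fun y : Fin 3 → ℝ => (y, t))
        (ContinuousLinearMap.inl ℝ (Fin 3 → ℝ) ℝ) x := hasFDerivAt_prodMk_left x t
    have h2 := (HasFDerivAt.comp x hd.hasFDerivAt h1).clm_apply
      (hasFDerivAt_const ((0, 1) : (Fin 3 → ℝ) × ℝ) x)
    have h3 := h2.fderiv
    unfold pd
    simp only [Function.comp_apply] at h3
    rw [h3]; simp
  have f3 : (fun y => deriv (fun s => g (y, s)) t) = fun y => fderiv ℝ g (y, t) (0, 1) :=
    funext e2
  rw [f3, f2, hs.eq]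
  refine f1.congr_of_eventuallyEq ?_
  filter_upwards [lt_mem_nhds ht] with s hs'
  exact e1 s hs' x

lemma smooth_interior {E : Type*} [NormedAddCommGroup E] [NormedSpace ℝ E]
    {g : (Fin 3 → ℝ) × ℝ → E} (hg : ContDiffOn ℝ ∞ g {q | 0 ≤ q.2})
    (q : (Fin 3 → ℝ) × ℝ) (hq : 0 < q.2) : ContDiffAt ℝ ∞ g q := by
  refine hg.contDiffAt ?_
  have : {q : (Fin 3 → ℝ) × ℝ | 0 < q.2} ∈ nhds q :=
    (isOpen_lt continuous_const continuous_snd).mem_nhds hq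
  exact Filter.mem_of_superset this (fun z (hz : 0 < z.2) => (le_of_lt hz : 0 ≤ z.2))

lemma smooth_slice {E : Type*} [NormedAddCommGroup E] [NormedSpace ℝ E]
    {g : (Fin 3 → ℝ) × ℝ → E} (hg : ContDiffOn ℝ ∞ g {q | 0 ≤ q.2}) (t : ℝ) (ht : 0 < t) :
    ContDiff ℝ ∞ (fun y => g (y, t)) := by
  rw [contDiff_iff_contDiffAt]
  intro y
  exact (smooth_interior hg (y, t) ht).comp y (contDiffAt_id.prodMk contDiffAt_const)

/-- The identity at a fixed time. -/
lemma core (μ lam : ℝ) (U f : Fin 3 → (Fin 3 → ℝ) → ℝ) (R P : (Fin 3 → ℝ) → ℝ)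
    (hU : ∀ i, ContDiff ℝ ∞ (U i)) (hf : ∀ i, ContDiff ℝ ∞ (f i))
    (hR : ContDiff ℝ ∞ R) (hP : ContDiff ℝ ∞ P) (x : Fin 3 → ℝ) :
    ∑ i, pd i (fun y => R y * (μ * (∑ j, pd j (pd j (U i)) y)
        - pd i (fun y => P y - lam * ∑ k, pd k (U k) y) y) + f i y
        - ∑ j, U j y * pd j (U i) y) x
      = (∑ i, pd i (fun y => ((μ + lam) * R y) * pd i (fun z => ∑ k, pd k (U k) z) y) x)
          - (∑ j, U j x * pd j (fun y => ∑ k, pd k (U k) y) x)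
          - (∑ i, pd i R x * pd i P x)
          - μ * (∑ i, pd i R x *
              (∑ j, ∑ k, eps i j k * pd j (fun y => ∑ a, ∑ b, eps k a b * pd a (U b) y) x))
          + (∑ i, (∑ a, ∑ b, eps i a b * pd a (U b) x) ^ 2)
          - (∑ i, ∑ j, (pd j (U i) x) ^ 2)
          - R x * (∑ i, pd i (pd i P) x)
          + (∑ i, pd i (f i) x) := by
  have h1 : ∀ i j, ContDiff ℝ ∞ (pd i (U j)) := fun i j => pd_smooth i (hU j)
  have h2 : ∀ k i j, ContDiff ℝ ∞ (pd k (pd i (U j))) := fun k i j => pd_smooth k (h1 i j)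
  have hP1 : ∀ i, ContDiff ℝ ∞ (pd i P) := fun i => pd_smooth i hP
  have hφ : ContDiff ℝ ∞ (fun y => ∑ k, pd k (U k) y) := ContDiff.sum fun k _ => h1 k k
  have c2 : ∀ i j k y, pd i (pd j (U k)) y = pd j (pd i (U k)) y :=
    fun i j k y => pd_comm i j (hU k) y
  -- gradient of the expansion rate
  have eφ : ∀ i, pd i (fun z => ∑ k, pd k (U k) z) = fun y => ∑ k, pd i (pd k (U k)) y :=
    fun i => funext fun y => pd_sum' i (fun k => h1 k k) y
  have hφ1 : ∀ i, ContDiff ℝ ∞ (fun y => ∑ k, pd i (pd k (U k)) y) :=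
    fun i => ContDiff.sum fun k _ => h2 i k k
  have ePφ : ∀ i y, pd i (fun y => P y - lam * ∑ k, pd k (U k) y) y
      = pd i P y - lam * ∑ k, pd i (pd k (U k)) y := by
    intro i y
    rw [pd_sub' i hP (contDiff_const.mul hφ), pd_cmul i lam hφ, eφ]
  have hL : ∀ i, ContDiff ℝ ∞ (fun y => ∑ j, pd j (pd j (U i)) y) :=
    fun i => ContDiff.sum fun j _ => h2 j j i
  have hA : ∀ i, ContDiff ℝ ∞ (fun y => μ * (∑ j, pd j (pd j (U i)) y)
      - (pd i P y - lam * ∑ k, pd i (pd k (U k)) y)) := fun i =>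
    (contDiff_const.mul (hL i)).sub ((hP1 i).sub (contDiff_const.mul (hφ1 i)))
  have hC : ∀ i, ContDiff ℝ ∞ (fun y => ∑ j, U j y * pd j (U i) y) :=
    fun i => ContDiff.sum fun j _ => (hU j).mul (h1 j i)
  have eL : ∀ i, pd i (fun y => R y * (μ * (∑ j, pd j (pd j (U i)) y)
        - pd i (fun y => P y - lam * ∑ k, pd k (U k) y) y) + f i y
        - ∑ j, U j y * pd j (U i) y) x
      = R x * (μ * (∑ j, pd i (pd j (pd j (U i))) x)
        - (pd i (pd i P) x - lam * ∑ k, pd i (pd i (pd k (U k))) x))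
        + pd i R x * (μ * (∑ j, pd j (pd j (U i)) x)
          - (pd i P x - lam * ∑ k, pd i (pd k (U k)) x))
        + pd i (f i) x
        - ∑ j, (U j x * pd i (pd j (U i)) x + pd i (U j) x * pd j (U i) x) := by
    intro i
    simp only [ePφ]
    rw [pd_sub' i ((hR.mul (hA i)).add (hf i)) (hC i), pd_add' i (hR.mul (hA i)) (hf i),
      pd_mul' i hR (hA i),
      pd_sub' i (contDiff_const.mul (hL i)) ((hP1 i).sub (contDiff_const.mul (hφ1 i))),
      pd_cmul i μ (hL i), pd_sub' i (hP1 i) (contDiff_const.mul (hφ1 i)),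
      pd_cmul i lam (hφ1 i), pd_sum' i (fun j => h2 j j i), pd_sum' i (fun k => h2 i k k),
      pd_sum' i (fun j => (hU j).mul (h1 j i))]
    simp only [fun j => pd_mul' i (hU j) (h1 j i) x]
  have eR : ∀ i, pd i (fun y => ((μ + lam) * R y) * pd i (fun z => ∑ k, pd k (U k) z) y) x
      = (μ + lam) * R x * (∑ k, pd i (pd i (pd k (U k))) x)
        + (μ + lam) * pd i R x * (∑ k, pd i (pd k (U k)) x) := by
    intro i
    rw [eφ, pd_mul' i (contDiff_const.mul hR) (hφ1 i), pd_cmul i _ hR,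
      pd_sum' i (fun k => h2 i k k)]
  have eV : ∀ j k, pd j (fun y => ∑ a, ∑ b, eps k a b * pd a (U b) y) x
      = ∑ a, ∑ b, eps k a b * pd j (pd a (U b)) x := by
    intro j k
    rw [pd_sum' j (fun a => ContDiff.sum fun b _ => contDiff_const.mul (h1 a b))]
    refine Finset.sum_congr rfl fun a _ => ?_
    rw [pd_sum' j (fun b => contDiff_const.mul (h1 a b))]
    exact Finset.sum_congr rfl fun b _ => pd_cmul j _ (h1 a b) x
  -- third derivatives
  have c3 : ∀ i j, pd i (pd j (pd j (U i))) x = pd j (pd j (pd i (U i))) x := by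
    intro i j
    rw [pd_comm i j (h1 j i) x]
    congr 1
    exact funext fun y => c2 i j i y
  simp only [eL, eR, eV]
  simp only [eφ]
  simp only [Fin.sum_univ_three]
  have e10 : ∀ k, pd 1 (pd 0 (U k)) x = pd 0 (pd 1 (U k)) x := fun k => c2 1 0 k x
  have e20 : ∀ k, pd 2 (pd 0 (U k)) x = pd 0 (pd 2 (U k)) x := fun k => c2 2 0 k x
  have e21 : ∀ k, pd 2 (pd 1 (U k)) x = pd 1 (pd 2 (U k)) x := fun k => c2 2 1 k x
  simp only [e10, e20, e21]
  rw [c3 0 1, c3 0 2, c3 1 0, c3 1 2, c3 2 0, c3 2 1]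
  simp only [eps, Fin.isValue, Fin.coe_ofNat_eq_mod, Nat.zero_mod, Nat.one_mod, Nat.reduceMod,
    Nat.cast_zero, Nat.cast_one, Nat.cast_ofNat]
  ring

/-- The expansion-rate equation for a viscous compressible fluid flow:
`∂_t φ = Σ_i ∂_i(((μ+λ)/ρ) ∂_i φ) − (u·∇)φ − ∇(1/ρ)·∇p − μ ∇(1/ρ)·(∇∧ω)
  + |ω|² − |∇u|² − (1/ρ)Δp + ∇·F`. -/
theorem statement_7 (μ lam : ℝ) (u : (Fin 3 → ℝ) → ℝ → Fin 3 → ℝ)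
    (ρ pr : (Fin 3 → ℝ) → ℝ → ℝ) (F : (Fin 3 → ℝ) → ℝ → Fin 3 → ℝ)
    (hu : ContDiffOn ℝ (⊤ : ℕ∞) (fun q : (Fin 3 → ℝ) × ℝ => u q.1 q.2) {q | 0 ≤ q.2})
    (hρ : ContDiffOn ℝ (⊤ : ℕ∞) (fun q : (Fin 3 → ℝ) × ℝ => ρ q.1 q.2) {q | 0 ≤ q.2})
    (hpr : ContDiffOn ℝ (⊤ : ℕ∞) (fun q : (Fin 3 → ℝ) × ℝ => pr q.1 q.2) {q | 0 ≤ q.2})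
    (hF : ContDiffOn ℝ (⊤ : ℕ∞) (fun q : (Fin 3 → ℝ) × ℝ => F q.1 q.2) {q | 0 ≤ q.2})
    (hpos : ∀ x t, 0 ≤ t → 0 < ρ x t)
    (hmom : ∀ (x : Fin 3 → ℝ) (t : ℝ), 0 < t → ∀ i,
      ρ x t * (deriv (fun s => u x s i) t + ∑ j, u x t j * pd j (fun y => u y t i) x)
        = μ * (∑ j, pd j (pd j (fun y => u y t i)) x)
          - pd i (fun y => pr y t - lam * expR u y t) x + ρ x t * F x t i) :
    ∀ (x : Fin 3 → ℝ) (t : ℝ), 0 < t →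
      deriv (fun s => expR u x s) t
        = (∑ i, pd i (fun y => ((μ + lam) / ρ y t) * pd i (fun z => expR u z t) y) x)
          - (∑ j, u x t j * pd j (fun y => expR u y t) x)
          - (∑ i, pd i (fun y => (ρ y t)⁻¹) x * pd i (fun y => pr y t) x)
          - μ * (∑ i, pd i (fun y => (ρ y t)⁻¹) x *
              (∑ j, ∑ k, eps i j k * pd j (fun y => vort u y t k) x))
          + (∑ i, (vort u x t i) ^ 2)
          - (∑ i, ∑ j, (pd j (fun y => u y t i) x) ^ 2)
          - (ρ x t)⁻¹ * (∑ i, pd i (pd i (fun y => pr y t)) x)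
          + (∑ i, pd i (fun y => F y t i) x) := by
  intro x t ht
  have hui : ∀ i, ContDiffOn ℝ ∞ (fun q : (Fin 3 → ℝ) × ℝ => u q.1 q.2 i) {q | 0 ≤ q.2} :=
    fun i => contDiffOn_pi.1 hu i
  have hFi : ∀ i, ContDiffOn ℝ ∞ (fun q : (Fin 3 → ℝ) × ℝ => F q.1 q.2 i) {q | 0 ≤ q.2} :=
    fun i => contDiffOn_pi.1 hF i
  have hU : ∀ i, ContDiff ℝ ∞ (fun y => u y t i) := fun i => smooth_slice (hui i) t ht
  have hf : ∀ i, ContDiff ℝ ∞ (fun y => F y t i) := fun i => smooth_slice (hFi i) t ht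
  have hP : ContDiff ℝ ∞ (fun y => pr y t) := smooth_slice hpr t ht
  have hρ' : ContDiff ℝ ∞ (fun y => ρ y t) := smooth_slice hρ t ht
  have hR : ContDiff ℝ ∞ (fun y => (ρ y t)⁻¹) := hρ'.inv fun y => (hpos y t ht.le).ne'
  have hT : deriv (fun s => expR u x s) t
      = ∑ i, pd i (fun y => deriv (fun s => u y s i) t) x := by
    have := HasDerivAt.fun_sum (u := Finset.univ) fun i (_ : i ∈ Finset.univ) =>
      pd_time i (g := fun q => u q.1 q.2 i) (smooth_interior (hui i)) x t ht
    exact this.deriv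
  have hm : ∀ i, (fun y => deriv (fun s => u y s i) t) = fun y =>
      (ρ y t)⁻¹ * (μ * (∑ j, pd j (pd j (fun y => u y t i)) y)
        - pd i (fun y => pr y t - lam * ∑ k, pd k (fun y => u y t k) y) y) + F y t i
        - ∑ j, u y t j * pd j (fun y => u y t i) y := by
    intro i
    funext y
    have h := hmom y t ht i
    have hne := (hpos y t ht.le).ne'
    simp only [expR] at h
    field_simp
    linarith
  rw [hT]
  simp only [hm]
  have hc := core μ lam (fun i y => u y t i) (fun i y => F y t i) (fun y => (ρ y t)⁻¹)
    (fun y => pr y t) hU hf hR hP x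
  simp only [div_eq_mul_inv]
  exact hc
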